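/- Let B be a subset of ℝ that is simultaneously a Bernstein set and a subgroup of (ℝ, +). Then for every finite union U = (B + x₁) ∪ ⋯ ∪ (B + xₙ) of cosets of B and all sets M, N ⊆ ℝ of Lebesgue measure zero, the set (U \ M) ∪ N is not Lebesgue measurable. -/

import Mathlib

open MeasureTheory

/-- A Bernstein set: a set `B ⊆ ℝ` such that every uncountable closed subset
`F` of `ℝ` meets both `B` and its complement. -/
def IsBernstein (B : Set ℝ) : Prop :=
  ∀ F : Set ℝ, IsClosed F → ¬F.Countable → (F ∩ B).Nonempty ∧ (F ∩ Bᶜ).Nonempty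

/-- A null measurable set meeting every uncountable closed set has null complement. -/
theorem measure_compl_eq_zero_of_meets_closed {S : Set ℝ} (hS : NullMeasurableSet S volume)
    (h : ∀ F : Set ℝ, IsClosed F → ¬F.Countable → (F ∩ S).Nonempty) : volume Sᶜ = 0 := by
  by_contra hpos
  obtain ⟨t, hts, ht, hae⟩ := hS.compl.exists_measurable_subset_ae_eq
  rw [← measure_congr hae] at hpos
  obtain ⟨K, hKt, hK, hKpos⟩ := ht.exists_lt_isCompact (pos_iff_ne_zero.2 hpos)
  obtain ⟨a, haK, haS⟩ := h K hK.isClosed fun hc => hKpos.ne' (hc.measure_zero volume)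
  exact hts (hKt haK) haS

theorem IsBernstein.not_nullMeasurableSet {B : Set ℝ} (hB : IsBernstein B) :
    ¬NullMeasurableSet B volume := by
  intro h
  have h₁ := measure_compl_eq_zero_of_meets_closed h fun F hF hc => (hB F hF hc).1
  have h₂ := measure_compl_eq_zero_of_meets_closed h.compl fun F hF hc => (hB F hF hc).2
  rw [compl_compl] at h₂
  have h₃ : volume (B ∪ Bᶜ) = 0 := measure_union_null h₂ h₁
  simp at h₃

/-- Every uncountable closed set meets every translate of a Bernstein set. -/
theorem IsBernstein.exists_sub_mem {B : Set ℝ} (hB : IsBernstein B) (y : ℝ) {F : Set ℝ}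
    (hF : IsClosed F) (hc : ¬F.Countable) : ∃ a ∈ F, a - y ∈ B := by
  have hcl : IsClosed ((fun b => b + y) ⁻¹' F) := hF.preimage (by fun_prop)
  have hunc : ¬((fun b => b + y) ⁻¹' F).Countable := fun h => hc <| by
    have := h.image (fun b => b + y)
    rwa [Set.image_preimage_eq _ (add_right_surjective y)] at this
  obtain ⟨b, hbF, hbB⟩ := (hB _ hcl hunc).1
  exact ⟨b + y, hbF, by simpa using hbB⟩

/-- Finitely many cosets of a proper additive subgroup do not cover `ℝ`. -/
theorem AddSubgroup.exists_forall_sub_notMem {G : AddSubgroup ℝ} (hG : G ≠ ⊤) {ι : Type*}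
    [Finite ι] (x : ι → ℝ) : ∃ y, ∀ i, y - x i ∉ G := by
  by_contra! hcov
  have hsurj : Function.Surjective fun i => (x i : ℝ ⧸ G) := by
    intro q
    obtain ⟨y, rfl⟩ := QuotientAddGroup.mk_surjective q
    obtain ⟨i, hi⟩ := hcov y
    refine ⟨i, QuotientAddGroup.eq.2 ?_⟩
    rwa [neg_add_eq_sub]
  have : Finite (ℝ ⧸ G) := Finite.of_surjective _ hsurj
  refine hG ((AddSubgroup.eq_top_iff' G).2 fun r => ?_)
  have hcard : (Nat.card (ℝ ⧸ G) : ℝ) ≠ 0 := Nat.cast_ne_zero.2 Nat.card_pos.ne'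
  have h : Nat.card (ℝ ⧸ G) • ((r / Nat.card (ℝ ⧸ G) : ℝ) : ℝ ⧸ G) = 0 := card_nsmul_eq_zero'
  rw [← QuotientAddGroup.mk_nsmul, nsmul_eq_mul, mul_div_cancel₀ _ hcard] at h
  exact (QuotientAddGroup.eq_zero_iff r).1 h

theorem IsBernstein.iUnion_add_right {G : AddSubgroup ℝ} (hG : IsBernstein (G : Set ℝ))
    {ι : Type*} [Finite ι] [Nonempty ι] (x : ι → ℝ) :
    IsBernstein (⋃ i, (fun b => b + x i) '' (G : Set ℝ)) := by
  have htop : G ≠ ⊤ := by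
    rintro rfl
    simpa using (hG Set.univ isClosed_univ Set.not_countable_univ).2
  obtain ⟨y, hy⟩ := G.exists_forall_sub_notMem htop x
  refine fun F hF hc => ⟨?_, ?_⟩
  · obtain ⟨i⟩ := ‹Nonempty ι›
    obtain ⟨a, haF, ha⟩ := hG.exists_sub_mem (x i) hF hc
    exact ⟨a, haF, Set.mem_iUnion.2 ⟨i, a - x i, ha, sub_add_cancel a (x i)⟩⟩
  · obtain ⟨a, haF, ha⟩ := hG.exists_sub_mem y hF hc
    refine ⟨a, haF, fun hmem => ?_⟩
    obtain ⟨i, b, hb, rfl⟩ := Set.mem_iUnion.1 hmem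
    refine hy i ?_
    convert G.sub_mem hb ha using 1
    ring

theorem stmt_6 (B : Set ℝ) (hB : IsBernstein B)
    (hsub : ∃ G : AddSubgroup ℝ, (G : Set ℝ) = B)
    (n : ℕ) (x : Fin (n + 1) → ℝ)
    (U : Set ℝ) (hU : U = ⋃ i, (fun b => b + x i) '' B)
    (M N : Set ℝ) (hM : volume M = 0) (hN : volume N = 0) :
    ¬NullMeasurableSet ((U \ M) ∪ N) volume := by
  obtain ⟨G, rfl⟩ := hsub
  subst hU
  intro h
  exact (hB.iUnion_add_right x).not_nullMeasurableSet <| h.congr <|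
    (union_ae_eq_left_of_ae_eq_empty (ae_eq_empty.2 hN)).trans (sdiff_null_ae_eq_self hM)
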